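/- arXiv:2007.13687 — 5 statements merged into one kernel-verified Lean document; each statement's English description precedes it below -/
import Mathlib

section
/- Let θ ≥ 0 and s ≥ 0 be real numbers. Then the function x ↦ log(1 + θ·x/(1 + s·x)) is concave on the interval [0, ∞). -/
/-- For `θ ≥ 0` and `s ≥ 0`, the function `x ↦ θx/(1 + sx)` is concave on `[0, ∞)`. -/
lemma concaveOn_mul_div_one_add_mul {θ s : ℝ} (hθ : 0 ≤ θ) (hs : 0 ≤ s) :
    ConcaveOn ℝ (Set.Ici (0 : ℝ)) (fun x => θ * x / (1 + s * x)) := by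
  refine ⟨convex_Ici 0, fun x hx y hy a b ha hb hab => ?_⟩
  rw [Set.mem_Ici] at hx hy
  simp only [smul_eq_mul]
  have hX : 0 < 1 + s * x := by positivity
  have hY : 0 < 1 + s * y := by positivity
  have hZ : 0 < 1 + s * (a * x + b * y) := by positivity
  obtain rfl : b = 1 - a := by linarith
  have key : θ * (a * x + (1 - a) * y) / (1 + s * (a * x + (1 - a) * y)) -
      (a * (θ * x / (1 + s * x)) + (1 - a) * (θ * y / (1 + s * y))) =
      θ * s * a * (1 - a) * (x - y) ^ 2 /
        ((1 + s * x) * (1 + s * y) * (1 + s * (a * x + (1 - a) * y))) := by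
    field_simp
    ring
  rw [← sub_nonneg, key]
  positivity

/-- For `θ ≥ 0` and `s ≥ 0`, the function `x ↦ log(1 + θx/(1 + sx))` is concave
on `[0, ∞)`. -/
theorem concave_log_rate
    (θ s : ℝ) (hθ : 0 ≤ θ) (hs : 0 ≤ s) :
    ConcaveOn ℝ (Set.Ici (0 : ℝ))
      (fun x => Real.log (1 + θ * x / (1 + s * x))) := by
  have hg := (concaveOn_const (1 : ℝ) (convex_Ici (0 : ℝ))).add
    (concaveOn_mul_div_one_add_mul hθ hs)
  have hpos : ∀ x ∈ Set.Ici (0 : ℝ), 0 < 1 + θ * x / (1 + s * x) := fun x hx => by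
    rw [Set.mem_Ici] at hx
    positivity
  refine ⟨convex_Ici 0, fun x hx y hy a b ha hb hab => ?_⟩
  have hlog := strictConcaveOn_log_Ioi.concaveOn
  exact (hlog.2 (hpos x hx) (hpos y hy) ha hb hab).trans <|
    Real.log_le_log (hlog.1 (hpos x hx) (hpos y hy) ha hb hab) (hg.2 hx hy ha hb hab)
end

section
/- Let γ > 0, P > 0, c > 0 be real numbers, M ≥ 2 a natural number, and δ ∈ (0,1). Set A = c/(γ·(M−1)·P), and suppose w > 0 satisfies w·exp(w) = A·exp(A)·(1−δ)^{−1/(M−1)} (the defining equation of the principal branch of the Lambert W function). Then ξ := 2γ(M−1)·w − 2c/P satisfies 1 + ξ·P/(2c) > 0 and exp(−ξ/(2γ)) / (1 + ξ·P/(2c))^{M−1} = 1 − δ. -/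
/-- Closed-form expression (Lemma 2, eq. (18)) of the upper endpoint of the
feasible interval via the principal Lambert W branch: if `w > 0` satisfies
`w·e^w = A·e^A·(1−δ)^{−1/(M−1)}` with `A = c/(γ(M−1)P)`, then
`ξ = 2γ(M−1)w − 2c/P` solves `exp(−ξ/(2γ))/(1 + ξP/(2c))^{M−1} = 1 − δ`. -/
theorem lambertW_closed_form_xi_ub
    (γ P c : ℝ) (hγ : 0 < γ) (hP : 0 < P) (hc : 0 < c)
    (M : ℕ) (hM : 2 ≤ M) (δ : ℝ) (hδ : δ ∈ Set.Ioo (0 : ℝ) 1)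
    (A : ℝ) (hA : A = c / (γ * (M - 1) * P))
    (w : ℝ) (hw : 0 < w)
    (hweq : w * Real.exp w =
      A * Real.exp A * (1 - δ) ^ (-(1 : ℝ) / (M - 1)))
    (ξ : ℝ) (hξ : ξ = 2 * γ * (M - 1) * w - 2 * c / P) :
    0 < 1 + ξ * P / (2 * c) ∧
    Real.exp (-ξ / (2 * γ)) / (1 + ξ * P / (2 * c)) ^ (M - 1) = 1 - δ := by
  obtain ⟨n, rfl⟩ : ∃ n, M = n + 1 := ⟨M - 1, by omega⟩
  have hn : n ≠ 0 := by omega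
  have hn0 : (0 : ℝ) < n := by exact_mod_cast Nat.pos_of_ne_zero hn
  have hδ0 : 0 < 1 - δ := sub_pos.mpr hδ.2
  simp only [Nat.cast_add, Nat.cast_one, add_sub_cancel_right, Nat.add_sub_cancel] at *
  have hApos : 0 < A := by rw [hA]; positivity
  have hbase : 1 + ξ * P / (2 * c) = w / A := by
    rw [hξ, hA]
    field_simp
    ring
  have hexponent : -ξ / (2 * γ) = n * (A - w) := by
    rw [hξ, hA]
    field_simp
    ring
  have hroot : (1 - δ) ^ (-(1 : ℝ) / n) = ((1 - δ) ^ (n : ℝ)⁻¹)⁻¹ := by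
    rw [neg_div, one_div, Real.rpow_neg hδ0.le]
  have hratio : Real.exp (A - w) / (w / A) = (1 - δ) ^ (n : ℝ)⁻¹ := by
    have hr : 0 < (1 - δ) ^ (n : ℝ)⁻¹ := Real.rpow_pos_of_pos hδ0 _
    rw [hroot, ← div_eq_mul_inv, eq_div_iff hr.ne'] at hweq
    generalize (1 - δ) ^ (n : ℝ)⁻¹ = r at hweq
    rw [Real.exp_sub]
    field_simp
    linarith
  rw [hbase]
  refine ⟨div_pos hw hApos, ?_⟩
  rw [hexponent, Real.exp_nat_mul, ← div_pow, hratio, Real.rpow_inv_natCast_pow hδ0.le hn]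
end

section
/- Let n ≥ 1 be a natural number, let A, B : Matrix (Fin n) (Fin n) ℂ be positive semidefinite matrices, let hAB be the Hermitian witness of Λ := A − B, and let L ≥ 0 be real. Then Re(Tr Λ) + √(2L)·‖Λ‖_F + L·max(λ_max(Λ), 0) ≤ (1 + √(2L) + L)·Re(Tr A) − Re(Tr B) + √(2L)·‖B‖_F, where ‖·‖_F denotes the Frobenius norm √(∑_{i,j} ‖·‖²) and λ_max(Λ) = max over i of hAB.eigenvalues i. -/
open scoped Matrix.Norms.Frobenius in
theorem Matrix.frobenius_norm_eq_sqrt {m n α : Type*} [Fintype m] [Fintype n]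
    [SeminormedAddCommGroup α] (A : Matrix m n α) :
    ‖A‖ = √(∑ i, ∑ j, ‖A i j‖ ^ 2) := by
  simp [Matrix.frobenius_norm_def, Real.sqrt_eq_rpow]

open scoped ComplexOrder Matrix.Norms.Frobenius in
theorem Matrix.PosSemidef.frobenius_norm_le_re_trace {n : Type*} [Fintype n]
    {A : Matrix n n ℂ} (hA : A.PosSemidef) : ‖A‖ ≤ A.trace.re := by
  classical
  obtain ⟨C, rfl⟩ : ∃ C : Matrix n n ℂ, A = star C * C := by
    open scoped MatrixOrder Matrix.Norms.L2Operator in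
    exact CStarAlgebra.nonneg_iff_eq_star_mul_self.mp hA.nonneg
  calc ‖star C * C‖ ≤ ‖star C‖ * ‖C‖ := frobenius_norm_mul _ _
    _ = ∑ i, ∑ j, ‖C i j‖ ^ 2 := by
      rw [star_eq_conjTranspose, frobenius_norm_conjTranspose, frobenius_norm_eq_sqrt,
        Real.mul_self_sqrt (by positivity)]
    _ = (star C * C).trace.re := by
      rw [Finset.sum_comm]
      simp [Matrix.trace, Matrix.mul_apply, Complex.sq_norm, Complex.normSq_apply]

open scoped ComplexOrder in
theorem Matrix.PosSemidef.re_diag_le_re_trace {n : Type*} [Fintype n]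
    {A : Matrix n n ℂ} (hA : A.PosSemidef) (i : n) : (A i i).re ≤ A.trace.re := by
  rw [Matrix.trace, Complex.re_sum]
  exact Finset.single_le_sum (f := fun j ↦ (A j j).re)
    (fun j _ ↦ (Complex.le_def.mp hA.diag_nonneg).1) (Finset.mem_univ i)

open scoped ComplexOrder in
theorem Matrix.IsHermitian.eigenvalues_sub_le_re_trace {n : Type*} [Fintype n] [DecidableEq n]
    {A B : Matrix n n ℂ} (hA : A.PosSemidef) (hB : B.PosSemidef) (hAB : (A - B).IsHermitian)
    (i : n) : hAB.eigenvalues i ≤ A.trace.re := by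
  set U : Matrix n n ℂ := hAB.eigenvectorUnitary.1
  have hdiag : star U * A * U - star U * B * U =
      diagonal (RCLike.ofReal ∘ hAB.eigenvalues) := by
    rw [← hAB.conjStarAlgAut_star_eigenvectorUnitary, Unitary.conjStarAlgAut_star_apply,
      Matrix.mul_sub, Matrix.sub_mul]
  have hB' : 0 ≤ ((star U * B * U) i i).re :=
    (Complex.le_def.mp (hB.conjTranspose_mul_mul_same U).diag_nonneg).1
  have hA' : ((star U * A * U) i i).re ≤ (star U * A * U).trace.re :=
    (hA.conjTranspose_mul_mul_same U).re_diag_le_re_trace i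
  have htr : (star U * A * U).trace = A.trace := by
    rw [Matrix.trace_mul_cycle, Unitary.mul_star_self_of_mem hAB.eigenvectorUnitary.2, one_mul]
  have hi : ((star U * A * U) i i).re - ((star U * B * U) i i).re = hAB.eigenvalues i := by
    simpa using congr_arg (fun M : Matrix n n ℂ ↦ (M i i).re) hdiag
  rw [htr] at hA'
  linarith

open scoped ComplexOrder in
/-- Deterministic matrix-analytic core of Lemma 1 (ineqs. (41)–(43)):
for positive semidefinite `A, B`, `Λ = A − B` and `L ≥ 0`,
`Tr(Λ) + √(2L)‖Λ‖_F + L·[λ_max(Λ)]⁺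
  ≤ (1 + √(2L) + L)·Tr(A) − Tr(B) + √(2L)‖B‖_F`. -/
theorem bernstein_rhs_bound
    (n : ℕ) (hn : 1 ≤ n)
    (A B : Matrix (Fin n) (Fin n) ℂ)
    (hA : A.PosSemidef) (hB : B.PosSemidef)
    (hAB : (A - B).IsHermitian)
    (L : ℝ) (hL : 0 ≤ L) :
    ((A - B).trace).re
      + Real.sqrt (2 * L) * Real.sqrt (∑ i, ∑ j, ‖(A - B) i j‖ ^ 2)
      + L * max (⨆ i, hAB.eigenvalues i) 0
    ≤ (1 + Real.sqrt (2 * L) + L) * (A.trace).re - (B.trace).re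
      + Real.sqrt (2 * L) * Real.sqrt (∑ i, ∑ j, ‖B i j‖ ^ 2) := by
  have htr : (A - B).trace.re = A.trace.re - B.trace.re := by simp
  have hA0 : 0 ≤ A.trace.re := (Complex.le_def.mp hA.trace_nonneg).1
  have hmax : max (⨆ i, hAB.eigenvalues i) 0 ≤ A.trace.re :=
    max_le (Real.iSup_le (hAB.eigenvalues_sub_le_re_trace hA hB) hA0) hA0
  have hF : √(∑ i, ∑ j, ‖(A - B) i j‖ ^ 2) ≤ A.trace.re + √(∑ i, ∑ j, ‖B i j‖ ^ 2) := by
    open scoped Matrix.Norms.Frobenius in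
    simp only [← Matrix.frobenius_norm_eq_sqrt]
    exact (norm_sub_le A B).trans (by gcongr; exact hA.frobenius_norm_le_re_trace)
  rw [htr]
  linarith [mul_le_mul_of_nonneg_left hmax hL,
    mul_le_mul_of_nonneg_left hF (Real.sqrt_nonneg (2 * L))]
end

section
/- Let r > 0, c ≥ 0, d ≥ 0 be real numbers and k ≥ 1 a natural number. Let μ be the exponential distribution on ℝ with rate 1/2 (density (1/2)e^{−x/2} on [0,∞)) and ν the Gamma distribution on ℝ with shape k and rate r (density r^k y^{k−1} e^{−ry}/Γ(k) on [0,∞)). Then the product measure μ × ν assigns to the set {(x, y) : x < c·y + d} the value 1 − exp(−d/2)·(r/(r + c/2))^k. -/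
open MeasureTheory ProbabilityTheory in
/-- The survival function of the exponential distribution. -/
lemma expMeasure_Ici {r x : ℝ} (hr : 0 < r) (hx : 0 ≤ x) :
    expMeasure r (Set.Ici x) = ENNReal.ofReal (Real.exp (-(r * x))) := by
  have := isProbabilityMeasure_expMeasure hr
  have : NullSingletonClass (expMeasure r) := by unfold expMeasure gammaMeasure; infer_instance
  have hle : Real.exp (-(r * x)) ≤ 1 := Real.exp_le_one_iff.2 (by nlinarith)
  have hcdf : expMeasure r (Set.Iic x) = ENNReal.ofReal (1 - Real.exp (-(r * x))) := by
    rw [← ofReal_cdf, cdf_expMeasure_eq hr, if_pos hx]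
  rw [← measure_congr Ioi_ae_eq_Ici, ← Set.compl_Iic, prob_compl_eq_one_sub measurableSet_Iic,
    hcdf, ← ENNReal.ofReal_one, ← ENNReal.ofReal_sub _ (sub_nonneg.2 hle), sub_sub_cancel]

open ProbabilityTheory in
/-- Exponential tilting turns a gamma density into a multiple of another gamma density. -/
lemma gammaPDF_mul_exp_neg {a r s : ℝ} (hr : 0 < r) (hs : 0 ≤ s) (x : ℝ) :
    gammaPDF a r x * ENNReal.ofReal (Real.exp (-(s * x))) =
      ENNReal.ofReal ((r / (r + s)) ^ a) * gammaPDF a (r + s) x := by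
  rcases lt_or_ge x 0 with hx | hx
  · simp [gammaPDF_of_neg hx]
  · have hrs : 0 < r + s := by positivity
    rw [gammaPDF_of_nonneg hx, gammaPDF_of_nonneg hx, ← ENNReal.ofReal_mul' (by positivity),
      ← ENNReal.ofReal_mul (by positivity), Real.div_rpow hr.le hrs.le, add_mul, neg_add,
      Real.exp_add]
    have := (Real.rpow_pos_of_pos hrs a).ne'
    field_simp

open MeasureTheory ProbabilityTheory in
/-- The Laplace transform of the gamma distribution. -/
lemma lintegral_exp_neg_mul_gammaMeasure {a r s : ℝ} (ha : 0 < a) (hr : 0 < r) (hs : 0 ≤ s) :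
    ∫⁻ x, ENNReal.ofReal (Real.exp (-(s * x))) ∂gammaMeasure a r =
      ENNReal.ofReal ((r / (r + s)) ^ a) := by
  have hpdf (b t : ℝ) : Measurable (gammaPDF b t) :=
    (measurable_gammaPDFReal b t).ennreal_ofReal
  rw [gammaMeasure, lintegral_withDensity_eq_lintegral_mul _ (hpdf a r) (by fun_prop)]
  simp only [Pi.mul_apply, gammaPDF_mul_exp_neg hr hs]
  rw [lintegral_const_mul _ (hpdf a (r + s)), lintegral_gammaPDF_eq_one ha (by positivity), mul_one]

open MeasureTheory ProbabilityTheory in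
lemma ae_nonneg_gammaMeasure (a r : ℝ) : ∀ᵐ x ∂gammaMeasure a r, 0 ≤ x := by
  rw [ae_iff]
  simp only [not_le]
  change gammaMeasure a r (Set.Iio 0) = 0
  rw [gammaMeasure, withDensity_apply _ measurableSet_Iio, lintegral_gammaPDF_of_nonpos le_rfl]

open MeasureTheory ProbabilityTheory in
/-- Closed-form connection outage probability (eq. (56)): if `X` is exponential
with rate `1/2` and `Y` is Gamma with shape `k` and rate `r`, independent, then
`Pr{X < cY + d} = 1 − e^{−d/2}·(r/(r + c/2))^k`. -/
theorem prob_exp_lt_affine_gamma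
    (r c d : ℝ) (hr : 0 < r) (hc : 0 ≤ c) (hd : 0 ≤ d)
    (k : ℕ) (hk : 1 ≤ k) :
    ((expMeasure (1 / 2)).prod (gammaMeasure k r))
        {p : ℝ × ℝ | p.1 < c * p.2 + d} =
      ENNReal.ofReal (1 - Real.exp (-d / 2) * (r / (r + c / 2)) ^ k) := by
  have hk' : (0 : ℝ) < k := by exact_mod_cast hk
  have := isProbabilityMeasure_expMeasure (r := 1 / 2) (by norm_num)
  have := isProbabilityMeasure_gammaMeasure hk' hr
  have hmeas : MeasurableSet {p : ℝ × ℝ | c * p.2 + d ≤ p.1} :=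
    measurableSet_le (by fun_prop) (by fun_prop)
  have hcompl : {p : ℝ × ℝ | p.1 < c * p.2 + d} = {p : ℝ × ℝ | c * p.2 + d ≤ p.1}ᶜ := by
    ext p; simp
  have hsurv : ((expMeasure (1 / 2)).prod (gammaMeasure k r)) {p : ℝ × ℝ | c * p.2 + d ≤ p.1} =
      ENNReal.ofReal (Real.exp (-d / 2) * (r / (r + c / 2)) ^ k) := by
    rw [Measure.prod_apply_symm hmeas]
    calc ∫⁻ y, expMeasure (1 / 2) (Set.Ici (c * y + d)) ∂gammaMeasure k r
        = ∫⁻ y, ENNReal.ofReal (Real.exp (-d / 2)) *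
            ENNReal.ofReal (Real.exp (-(c / 2 * y))) ∂gammaMeasure k r := by
          refine lintegral_congr_ae ?_
          filter_upwards [ae_nonneg_gammaMeasure k r] with y hy
          rw [expMeasure_Ici (by norm_num) (by positivity),
            ← ENNReal.ofReal_mul (Real.exp_pos _).le, ← Real.exp_add]
          ring_nf
      _ = ENNReal.ofReal (Real.exp (-d / 2) * (r / (r + c / 2)) ^ k) := by
          rw [lintegral_const_mul _ (by fun_prop),
            lintegral_exp_neg_mul_gammaMeasure hk' hr (by positivity), Real.rpow_natCast,
            ← ENNReal.ofReal_mul (Real.exp_pos _).le]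
  rw [hcompl, prob_compl_eq_one_sub hmeas, hsurv, ← ENNReal.ofReal_one,
    ← ENNReal.ofReal_sub _ (by positivity)]
end

section
/- Let N ≥ 2 be a natural number. Let μ be the measure on ℝ with density x ↦ (N−1)·(1−x)^{N−2} on [0,1] (and zero elsewhere) with respect to Lebesgue measure, i.e., the Beta(1, N−1) distribution, and let ν be the Gamma distribution on ℝ with shape N and rate 1/2 (the chi-squared distribution with 2N degrees of freedom, density t^{N−1}e^{−t/2}/(2^N Γ(N)) on [0,∞)). Then for every x ≥ 0, the product measure μ × ν assigns to the set {(u, t) : u·t ≤ x} the value 1 − exp(−x/2); that is, the product of independent Beta(1, N−1) and χ²(2N) random variables is exponentially distributed with rate 1/2. -/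
open MeasureTheory in
/-- The mass that the `Beta(1, n + 1)` density puts on `(c, 1]`. -/
lemma lintegral_Ioc_succ_mul_one_sub_pow (n : ℕ) {c : ℝ} (hc : c ≤ 1) :
    ∫⁻ u in Set.Ioc c 1, ENNReal.ofReal ((n + 1 : ℝ) * (1 - u) ^ n) =
      ENNReal.ofReal ((1 - c) ^ (n + 1)) := by
  rw [← ofReal_integral_eq_lintegral_ofReal, ← intervalIntegral.integral_of_le hc,
    intervalIntegral.integral_const_mul,
    intervalIntegral.integral_comp_sub_left (fun v : ℝ => v ^ n), integral_pow]
  · congr 1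
    simp only [sub_self, ne_eq, Nat.add_eq_zero_iff, one_ne_zero, and_false, not_false_eq_true,
      zero_pow, sub_zero]
    field_simp
  · exact (by fun_prop : Continuous fun u : ℝ => (n + 1 : ℝ) * (1 - u) ^ n).integrableOn_Ioc
  · refine (ae_restrict_iff' measurableSet_Ioc).2 (ae_of_all _ fun u hu => ?_)
    have : 0 ≤ 1 - u := sub_nonneg.2 hu.2
    simp only [Pi.zero_apply]
    positivity

open MeasureTheory in
/-- The `Beta(1, N - 1)` measure of a set is the integral of the density over its part in
`[0, 1]`. If that part is `(c, 1]` up to a null set, the measure is `(1 - c) ^ (N - 1)`. -/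
lemma withDensity_beta_one_apply {N : ℕ} (hN : 2 ≤ N) {c : ℝ} (hc : c ≤ 1) {s : Set ℝ}
    (hs : MeasurableSet s) (h : (Set.Icc 0 1 ∩ s : Set ℝ) =ᵐ[volume] Set.Ioc c 1) :
    (volume.withDensity fun u : ℝ => ENNReal.ofReal
      (if u ∈ Set.Icc (0 : ℝ) 1 then (N - 1 : ℝ) * (1 - u) ^ (N - 2) else 0)) s =
      ENNReal.ofReal ((1 - c) ^ (N - 1)) := by
  obtain ⟨n, rfl⟩ := Nat.exists_eq_add_of_le' hN
  have hdens : (fun u : ℝ => ENNReal.ofReal (if u ∈ Set.Icc (0 : ℝ) 1 then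
      (((n + 2 : ℕ) : ℝ) - 1) * (1 - u) ^ (n + 2 - 2) else 0)) =
      (Set.Icc (0 : ℝ) 1).indicator
        fun u => ENNReal.ofReal ((n + 1 : ℝ) * (1 - u) ^ n) := by
    ext u
    rw [Set.indicator_apply]
    split_ifs
    · congr 2
      push_cast
      ring
    · simp
  rw [hdens, withDensity_apply _ hs, setLIntegral_indicator measurableSet_Icc,
    setLIntegral_congr h]
  exact lintegral_Ioc_succ_mul_one_sub_pow n hc

open MeasureTheory ProbabilityTheory in
/-- Weighting a gamma density by the `Beta(1, N - 1)` tail at `x / t` shifts it by `x`. -/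
lemma gammaPDF_mul_withDensity_beta_one_tail {N : ℕ} (hN : 2 ≤ N) {r x : ℝ} (hr : 0 < r)
    (hx : 0 ≤ x) (t : ℝ) :
    gammaPDF N r t *
      (volume.withDensity fun u : ℝ => ENNReal.ofReal
        (if u ∈ Set.Icc (0 : ℝ) 1 then (N - 1 : ℝ) * (1 - u) ^ (N - 2) else 0)) {u | x < u * t} =
      ENNReal.ofReal (Real.exp (-(r * x))) * gammaPDF N r (t - x) := by
  have hrpow (y : ℝ) : y ^ ((N : ℝ) - 1) = y ^ (N - 1) := by
    rw [← Real.rpow_natCast, Nat.cast_sub (by omega), Nat.cast_one]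
  have hN0 : N - 1 ≠ 0 := by omega
  have hms : MeasurableSet {u : ℝ | x < u * t} := measurableSet_lt (by fun_prop) (by fun_prop)
  rcases le_or_gt t x with htx | htx
  · have hR : gammaPDF N r (t - x) = 0 := by
      rcases htx.lt_or_eq with h | rfl
      · exact gammaPDF_of_neg (sub_neg.2 h)
      · rw [sub_self, gammaPDF_of_nonneg le_rfl, hrpow, zero_pow hN0]
        simp
    rw [hR, mul_zero]
    rcases lt_or_ge t 0 with ht | ht
    · rw [gammaPDF_of_neg ht, zero_mul]
    · have hempty : (Set.Icc 0 1 ∩ {u : ℝ | x < u * t} : Set ℝ) = Set.Ioc 1 1 := by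
        ext u
        simp only [Set.mem_inter_iff, Set.mem_Icc, Set.mem_ofPred_eq, Set.Ioc_self,
          Set.mem_empty_iff_false, iff_false]
        rintro ⟨⟨-, h1⟩, h⟩
        nlinarith
      rw [withDensity_beta_one_apply hN le_rfl hms (Filter.EventuallyEq.of_eq hempty), sub_self,
        zero_pow hN0, ENNReal.ofReal_zero, mul_zero]
  · have ht : 0 < t := hx.trans_lt htx
    have hIoc : (Set.Icc 0 1 ∩ {u : ℝ | x < u * t} : Set ℝ) = Set.Ioc (x / t) 1 := by
      ext u
      simp only [Set.mem_inter_iff, Set.mem_Icc, Set.mem_ofPred_eq, Set.mem_Ioc, div_lt_iff₀ ht]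
      refine ⟨fun h => ⟨h.2, h.1.2⟩, fun h => ⟨⟨?_, h.2⟩, h.1⟩⟩
      exact (pos_of_mul_pos_left (hx.trans_lt h.1) ht.le).le
    have hxt : 0 ≤ t - x := by linarith
    rw [withDensity_beta_one_apply hN ((div_le_one ht).2 htx.le) hms
      (Filter.EventuallyEq.of_eq hIoc), gammaPDF_of_nonneg ht.le,
      gammaPDF_of_nonneg hxt, ← ENNReal.ofReal_mul (by positivity),
      ← ENNReal.ofReal_mul (Real.exp_pos _).le, hrpow, hrpow]
    congr 1
    have hexp : Real.exp (-(r * t)) = Real.exp (-(r * x)) * Real.exp (-(r * (t - x))) := by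
      rw [← Real.exp_add]
      ring_nf
    have hpow : t ^ (N - 1) * (1 - x / t) ^ (N - 1) = (t - x) ^ (N - 1) := by
      rw [← mul_pow, mul_sub, mul_one, mul_div_cancel₀ _ ht.ne']
    rw [hexp, ← hpow]
    ring


open MeasureTheory ProbabilityTheory in
/-- The product of independent `Beta(1, N−1)` and `χ²(2N)` random variables is
exponential with rate `1/2` (eqs. (51)–(53) of Appendix A): for `x ≥ 0`,
`Pr{X₁·X₂ ≤ x} = 1 − e^{−x/2}`, where `X₁` has density `(N−1)(1−u)^{N−2}` on
`[0,1]` and `X₂ ~ Gamma(N, 1/2) = χ²(2N)`. -/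
theorem beta_mul_chiSq_is_exponential
    (N : ℕ) (hN : 2 ≤ N) :
    ∀ x : ℝ, 0 ≤ x →
      ((volume.withDensity fun u : ℝ =>
          ENNReal.ofReal
            (if u ∈ Set.Icc (0 : ℝ) 1 then (N - 1 : ℝ) * (1 - u) ^ (N - 2) else 0)).prod
        (gammaMeasure N (1 / 2)))
        {p : ℝ × ℝ | p.1 * p.2 ≤ x} =
      ENNReal.ofReal (1 - Real.exp (-x / 2)) := by
  intro x hx
  set β : Measure ℝ := volume.withDensity fun u : ℝ => ENNReal.ofReal
    (if u ∈ Set.Icc (0 : ℝ) 1 then (N - 1 : ℝ) * (1 - u) ^ (N - 2) else 0) with hβ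
  have hN0 : (0 : ℝ) < N := by exact_mod_cast (by omega : 0 < N)
  have : IsProbabilityMeasure β := ⟨by
    rw [hβ, withDensity_beta_one_apply hN zero_le_one MeasurableSet.univ
      (by rw [Set.inter_univ]; exact Ioc_ae_eq_Icc.symm)]
    simp⟩
  have : IsProbabilityMeasure (gammaMeasure N (1 / 2)) :=
    isProbabilityMeasure_gammaMeasure hN0 (by norm_num)
  have hms : MeasurableSet {p : ℝ × ℝ | x < p.1 * p.2} :=
    measurableSet_lt (by fun_prop) (by fun_prop)
  have htail : (β.prod (gammaMeasure N (1 / 2))) {p : ℝ × ℝ | x < p.1 * p.2} =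
      ENNReal.ofReal (Real.exp (-x / 2)) := by
    have hpdf : Measurable (gammaPDF N (1 / 2)) :=
      (measurable_gammaPDFReal N (1 / 2)).ennreal_ofReal
    rw [Measure.prod_apply_symm hms, gammaMeasure,
      lintegral_withDensity_eq_lintegral_mul _ hpdf (measurable_measure_prodMk_right hms)]
    calc ∫⁻ t, gammaPDF N (1 / 2) t * β {u | x < u * t}
        = ∫⁻ t, ENNReal.ofReal (Real.exp (-(1 / 2 * x))) * gammaPDF N (1 / 2) (t - x) :=
          lintegral_congr fun t => gammaPDF_mul_withDensity_beta_one_tail hN (by norm_num) hx t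
      _ = ENNReal.ofReal (Real.exp (-x / 2)) := by
          rw [lintegral_const_mul _ (by fun_prop), lintegral_sub_right_eq_self,
            lintegral_gammaPDF_eq_one hN0 (by norm_num), mul_one]
          ring_nf
  have hcompl : {p : ℝ × ℝ | p.1 * p.2 ≤ x} = {p : ℝ × ℝ | x < p.1 * p.2}ᶜ := by
    ext p
    simp
  rw [hcompl, prob_compl_eq_one_sub hms, htail, ENNReal.ofReal_sub _ (Real.exp_pos _).le,
    ENNReal.ofReal_one]
end
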